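/- Sphere-smoothing gradient identity (used to justify the two-point gradient estimator). If F : ℝ^D → ℝ is M₂-Lipschitz with respect to the Euclidean norm, then F_γ is differentiable on ℝ^D and for every x ∈ ℝ^D: ∇F_γ(x) = (D/γ)·E[F(x + γe)·e] = (D/(2γ))·E[(F(x + γe) − F(x − γe))·e], where e is a random vector uniformly distributed on the Euclidean unit sphere of ℝ^D. -/

import Mathlib

open MeasureTheory
open scoped ENNReal

noncomputable section

/-- The uniform probability distribution on the closed Euclidean unit ball of `ℝ^D`
(normalized restriction of Lebesgue measure). -/
def uniformBall (D : ℕ) : Measure (EuclideanSpace ℝ (Fin D)) :=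
  (volume (Metric.closedBall (0 : EuclideanSpace ℝ (Fin D)) 1))⁻¹ •
    volume.restrict (Metric.closedBall (0 : EuclideanSpace ℝ (Fin D)) 1)

/-- The smoothed function `F_γ(x) := E[F(x + γ ẽ)]`, with `ẽ` uniform on the closed
Euclidean unit ball. -/
def smoothed (D : ℕ) (F : EuclideanSpace ℝ (Fin D) → ℝ) (γ : ℝ)
    (x : EuclideanSpace ℝ (Fin D)) : ℝ :=
  ∫ u, F (x + γ • u) ∂(uniformBall D)

/-- The uniform probability distribution on the Euclidean unit sphere of `ℝ^D`
(normalized restriction of the `(D−1)`-dimensional Hausdorff measure to the sphere). -/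
def uniformSphere (D : ℕ) : Measure (EuclideanSpace ℝ (Fin D)) :=
  (μH[(D : ℝ) - 1] (Metric.sphere (0 : EuclideanSpace ℝ (Fin D)) 1))⁻¹ •
    (μH[(D : ℝ) - 1]).restrict (Metric.sphere (0 : EuclideanSpace ℝ (Fin D)) 1)


open Metric Set
open scoped RealInnerProductSpace NNReal

section SphereMeasures

variable {E : Type*} [NormedAddCommGroup E] [InnerProductSpace ℝ E] [MeasurableSpace E]
  [BorelSpace E]

theorem measure_ball_eq_of_measurePreserving {μ : Measure E}
    (hμ : ∀ T : E ≃ₗᵢ[ℝ] E, MeasurePreserving T μ μ) {x y : E} (hxy : ‖x‖ = ‖y‖) (r : ℝ) :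
    μ (ball x r) = μ (ball y r) := by
  have hT : (ℝ ∙ (x - y))ᗮ.reflection x = y := Submodule.reflection_sub hxy
  set T := (ℝ ∙ (x - y))ᗮ.reflection
  rw [← (hμ T).measure_preimage (s := ball y r) measurableSet_ball.nullMeasurableSet,
    T.preimage_ball, ← hT, T.symm_apply_apply]

theorem integrable_of_continuous_of_sphere_compl_null [FiniteDimensional ℝ E] {F : Type*}
    [NormedAddCommGroup F] [SecondCountableTopology F]
    {μ : Measure E} [IsFiniteMeasure μ] (hμ : μ (sphere 0 1)ᶜ = 0) {f : E → F}
    (hf : Continuous f) : Integrable f μ := by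
  borelize F
  obtain ⟨C, hC⟩ := (isCompact_sphere (0 : E) 1).exists_bound_of_continuousOn hf.continuousOn
  refine Integrable.of_bound (C := C) hf.measurable.aestronglyMeasurable ?_
  filter_upwards [mem_ae_iff.2 hμ] with x hx using hC x hx

/-- Any two finite measures on the unit sphere which are invariant under linear isometries are
proportional, tested against continuous functions. -/
theorem integral_eq_mul_integral_of_measurePreserving [FiniteDimensional ℝ E]
    {μ ν : Measure E} [IsProbabilityMeasure μ] [IsFiniteMeasure ν]
    (hμ : ∀ T : E ≃ₗᵢ[ℝ] E, MeasurePreserving T μ μ)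
    (hν : ∀ T : E ≃ₗᵢ[ℝ] E, MeasurePreserving T ν ν)
    (hμS : μ (sphere 0 1)ᶜ = 0) (hνS : ν (sphere 0 1)ᶜ = 0) {f : E → ℝ} (hf : Continuous f) :
    ∫ x, f x ∂ν = ν.real univ * ∫ x, f x ∂μ := by
  have hμae : ∀ᵐ x ∂μ, x ∈ sphere (0 : E) 1 := mem_ae_iff.2 hμS
  have hνae : ∀ᵐ x ∂ν, x ∈ sphere (0 : E) 1 := mem_ae_iff.2 hνS
  obtain ⟨x₀, hx₀⟩ := hμae.exists
  have hball : ∀ {ρ : Measure E}, (∀ T : E ≃ₗᵢ[ℝ] E, MeasurePreserving T ρ ρ) → ∀ r : ℝ,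
      ∀ x ∈ sphere (0 : E) 1, ρ.real (ball x r) = ρ.real (ball x₀ r) := by
    intro ρ hρ r x hx
    rw [measureReal_def, measureReal_def, measure_ball_eq_of_measurePreserving hρ]
    rw [mem_sphere_zero_iff_norm.1 hx, mem_sphere_zero_iff_norm.1 hx₀]
  have hpos : ∀ r > 0, 0 < μ.real (ball x₀ r) := by
    intro r hr
    by_contra! h
    have h0 : μ.real (ball x₀ r) = 0 := le_antisymm h measureReal_nonneg
    have : μ (sphere (0 : E) 1) = 0 := by
      refine measure_null_of_locally_null _ fun x hx ↦ ⟨ball x r,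
        mem_nhdsWithin_of_mem_nhds (ball_mem_nhds x hr), ?_⟩
      rwa [← measureReal_eq_zero_iff, hball hμ r x hx]
    have h2 := measure_univ (μ := μ)
    rw [← union_compl_self (sphere (0 : E) 1)] at h2
    have h3 := measure_union_le (μ := μ) (sphere (0 : E) 1) (sphere (0 : E) 1)ᶜ
    rw [h2, this, hμS] at h3
    simp at h3
  have hfμ := integrable_of_continuous_of_sphere_compl_null hμS hf
  have hfν := integrable_of_continuous_of_sphere_compl_null hνS hf
  have hmeas : ∀ r : ℝ, MeasurableSet {p : E × E | dist p.1 p.2 < r} := fun r ↦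
    (isOpen_lt (by fun_prop) continuous_const).measurableSet
  -- the kernel `1_{dist x y < r}` transports integrals between the two measures
  have key1 : ∀ r : ℝ, ∀ g : E → ℝ, Integrable g ν →
      ∫ p, {p : E × E | dist p.1 p.2 < r}.indicator (fun p ↦ g p.1) p ∂(ν.prod μ) =
        μ.real (ball x₀ r) * ∫ x, g x ∂ν := by
    intro r g hg
    rw [integral_prod _ ((hg.comp_fst μ).indicator (hmeas r)), ← integral_const_mul]
    refine integral_congr_ae ?_
    filter_upwards [hνae] with x hx
    have : (fun y ↦ {p : E × E | dist p.1 p.2 < r}.indicator (fun p ↦ g p.1) (x, y)) =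
        (ball x r).indicator fun _ ↦ g x := by
      ext y
      simp only [indicator, mem_ofPred_eq, mem_ball, dist_comm x y]
    rw [this, integral_indicator measurableSet_ball, setIntegral_const, hball hμ r x hx,
      smul_eq_mul]
  have key2 : ∀ r : ℝ, ∀ g : E → ℝ, Integrable g μ →
      ∫ p, {p : E × E | dist p.1 p.2 < r}.indicator (fun p ↦ g p.2) p ∂(ν.prod μ) =
        ν.real (ball x₀ r) * ∫ x, g x ∂μ := by
    intro r g hg
    rw [integral_prod_symm _ ((hg.comp_snd ν).indicator (hmeas r)), ← integral_const_mul]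
    refine integral_congr_ae ?_
    filter_upwards [hμae] with y hy
    have : (fun x ↦ {p : E × E | dist p.1 p.2 < r}.indicator (fun p ↦ g p.2) (x, y)) =
        (ball y r).indicator fun _ ↦ g y := by
      ext x
      simp only [indicator, mem_ofPred_eq, mem_ball]
    rw [this, integral_indicator measurableSet_ball, setIntegral_const, hball hν r y hy,
      smul_eq_mul]
  have hratio : ∀ r : ℝ, ν.real (ball x₀ r) = μ.real (ball x₀ r) * ν.real univ := by
    intro r
    have h1 := key1 r (fun _ ↦ 1) (integrable_const _)
    have h2 := key2 r (fun _ ↦ 1) (integrable_const _)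
    simp only [integral_const, smul_eq_mul, mul_one, probReal_univ] at h1 h2
    rw [← h1, ← h2]
  have hbound : ∀ ε > 0, |∫ x, f x ∂ν - ν.real univ * ∫ x, f x ∂μ| ≤ ε * ν.real univ := by
    intro ε hε
    obtain ⟨r, hr, hfr⟩ := Metric.uniformContinuousOn_iff.1
      ((isCompact_sphere (0 : E) 1).uniformContinuousOn_of_continuous hf.continuousOn) ε hε
    have hprod : ∀ᵐ p ∂(ν.prod μ), p.1 ∈ sphere (0 : E) 1 ∧ p.2 ∈ sphere (0 : E) 1 :=
      (Measure.quasiMeasurePreserving_fst.ae hνae).and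
        (Measure.quasiMeasurePreserving_snd.ae hμae)
    have hle := norm_integral_le_of_norm_le
      (f := fun p ↦ {p : E × E | dist p.1 p.2 < r}.indicator (fun p ↦ f p.1) p -
        {p : E × E | dist p.1 p.2 < r}.indicator (fun p ↦ f p.2) p)
      (g := {p : E × E | dist p.1 p.2 < r}.indicator (fun _ ↦ ε)) (μ := ν.prod μ)
      ((integrable_const ε).indicator (hmeas r)) (by
        filter_upwards [hprod] with p hp
        by_cases h : dist p.1 p.2 < r
        · simpa [indicator, h, Real.dist_eq] using (hfr _ hp.1 _ hp.2 h).le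
        · simp [indicator, h])
    rw [integral_sub ((hfν.comp_fst μ).indicator (hmeas r))
      ((hfμ.comp_snd ν).indicator (hmeas r)), key1 r f hfν, key2 r f hfμ,
      key1 r (fun _ ↦ ε) (integrable_const _), hratio, mul_assoc, ← mul_sub, norm_mul,
      Real.norm_of_nonneg (hpos r hr).le, integral_const, smul_eq_mul, mul_comm _ ε] at hle
    exact le_of_mul_le_mul_left hle (hpos r hr)
  refine eq_of_abs_sub_nonpos (le_of_forall_pos_le_add fun δ hδ ↦ ?_)
  rw [zero_add]
  refine (hbound (δ / (ν.real univ + 1)) (by positivity)).trans ?_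
  rw [div_mul_eq_mul_div, div_le_iff₀ (by positivity)]
  nlinarith [measureReal_nonneg (μ := ν) (s := univ)]

end SphereMeasures

section HausdorffSphere

theorem hausdorffMeasure_sphere_pos (n : ℕ) :
    0 < μH[(n : ℝ)] (sphere (0 : EuclideanSpace ℝ (Fin (n + 1))) 1) := by
  let L : EuclideanSpace ℝ (Fin (n + 1)) → Fin n → ℝ := fun x i ↦ x i.succ
  have hL : LipschitzWith 1 L := by
    refine LipschitzWith.of_dist_le_mul fun x y ↦ ?_
    rw [NNReal.coe_one, one_mul, dist_pi_le_iff dist_nonneg]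
    intro i
    rw [Real.dist_eq, dist_eq_norm]
    exact PiLp.norm_apply_le (x - y) i.succ
  let U : Set (Fin n → ℝ) := {y | ∑ i, y i ^ 2 < 1}
  have hU : IsOpen U := isOpen_lt (by fun_prop) continuous_const
  have hsub : U ⊆ L '' sphere 0 1 := by
    intro y hy
    refine ⟨WithLp.toLp 2 (Fin.cons √(1 - ∑ i, y i ^ 2) y), ?_, ?_⟩
    · rw [mem_sphere_zero_iff_norm, EuclideanSpace.norm_eq, Real.sqrt_eq_one]
      simp only [Real.norm_eq_abs, sq_abs, Fin.sum_univ_succ, Fin.cons_zero, Fin.cons_succ]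
      rw [Real.sq_sqrt (sub_nonneg.2 (le_of_lt hy))]
      ring
    · ext i
      simp [L]
  have hpos : 0 < μH[(n : ℝ)] U := by
    have h := hU.measure_pos volume ⟨0, by simp [U]⟩
    rwa [← hausdorffMeasure_pi_real, Fintype.card_fin] at h
  have h := hL.hausdorffMeasure_image_le (Nat.cast_nonneg n) (sphere 0 1)
  simp only [ENNReal.coe_one, ENNReal.one_rpow, one_mul] at h
  exact hpos.trans_le ((measure_mono hsub).trans h)

theorem hausdorffMeasure_sphere_lt_top (n : ℕ) :
    μH[(n : ℝ)] (sphere (0 : EuclideanSpace ℝ (Fin (n + 1))) 1) < ⊤ := by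
  let g : Fin (n + 1) × Bool → (Fin n → ℝ) → EuclideanSpace ℝ (Fin (n + 1)) := fun p y ↦
    WithLp.toLp 2 (p.1.insertNth (if p.2 then 1 else -1 : ℝ) y)
  have hg0 : ∀ p y, g p y ≠ 0 := by
    intro p y h
    have := congrArg (fun x : EuclideanSpace ℝ (Fin (n + 1)) ↦ x p.1) h
    simp only [g, Fin.insertNth_apply_same, PiLp.zero_apply] at this
    split_ifs at this <;> norm_num at this
  have hg : ∀ p, ContDiff ℝ 1 (g p) := by
    intro p
    rw [contDiff_euclidean]
    intro i
    refine p.1.succAboveCases ?_ (fun j ↦ ?_) i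
    · simp only [g, Fin.insertNth_apply_same]
      exact contDiff_const
    · simp only [g, Fin.insertNth_apply_succAbove]
      fun_prop
  let f : Fin (n + 1) × Bool → (Fin n → ℝ) → EuclideanSpace ℝ (Fin (n + 1)) := fun p y ↦
    ‖g p y‖⁻¹ • g p y
  have hf : ∀ p, ContDiff ℝ 1 (f p) := fun p ↦
    (((hg p).norm ℝ (hg0 p)).inv fun y ↦ norm_ne_zero_iff.2 (hg0 p y)).smul (hg p)
  have hsub : sphere (0 : EuclideanSpace ℝ (Fin (n + 1))) 1 ⊆ ⋃ p, f p '' closedBall 0 1 := by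
    intro x hx
    rw [mem_sphere_zero_iff_norm] at hx
    obtain ⟨i, hi⟩ := Finite.exists_max fun i ↦ |x i|
    have hxi : x i ≠ 0 := by
      intro h0
      have : x = 0 := by
        ext j
        simpa [h0] using hi j
      simp [this] at hx
    have hxi' : 0 < |x i| := abs_pos.2 hxi
    refine mem_iUnion.2 ⟨(i, decide (0 < x i)), fun j ↦ |x i|⁻¹ * x (i.succAbove j), ?_, ?_⟩
    · rw [mem_closedBall_zero_iff, pi_norm_le_iff_of_nonneg zero_le_one]
      intro j
      rw [norm_mul, norm_inv, Real.norm_eq_abs, abs_abs, Real.norm_eq_abs, inv_mul_le_iff₀ hxi',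
        mul_one]
      exact hi _
    · have hgx : g (i, decide (0 < x i)) (fun j ↦ |x i|⁻¹ * x (i.succAbove j)) =
          |x i|⁻¹ • x := by
        ext k
        refine i.succAboveCases ?_ (fun j ↦ ?_) k
        · simp only [g, Fin.insertNth_apply_same, decide_eq_true_eq, PiLp.smul_apply, smul_eq_mul]
          split_ifs with h
          · rw [abs_of_pos h, inv_mul_cancel₀ hxi]
          · rw [abs_of_neg (lt_of_le_of_ne (not_lt.1 h) hxi), inv_neg, neg_mul,
              inv_mul_cancel₀ hxi]
        · simp [g]
      simp only [f]
      rw [hgx, norm_smul, hx, norm_inv, Real.norm_eq_abs, abs_abs, mul_one, inv_inv, smul_smul,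
        mul_inv_cancel₀ hxi'.ne', one_smul]
  refine (measure_mono hsub).trans_lt ((measure_iUnion_le _).trans_lt ?_)
  rw [tsum_fintype]
  refine ENNReal.sum_lt_top.2 fun p _ ↦ ?_
  obtain ⟨K, hK⟩ := ((hf p).locallyLipschitz.locallyLipschitzOn).exists_lipschitzOnWith_of_compact
    (isCompact_closedBall (0 : Fin n → ℝ) 1)
  refine (hK.hausdorffMeasure_image_le (Nat.cast_nonneg n)).trans_lt ?_
  refine ENNReal.mul_lt_top (ENNReal.rpow_lt_top_of_nonneg (Nat.cast_nonneg n)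
    ENNReal.coe_ne_top) ?_
  have h := (isCompact_closedBall (0 : Fin n → ℝ) 1).measure_lt_top (μ := volume)
  rwa [← hausdorffMeasure_pi_real, Fintype.card_fin] at h

theorem isProbabilityMeasure_uniformSphere {D : ℕ} (hD : 0 < D) :
    IsProbabilityMeasure (uniformSphere D) := by
  obtain ⟨n, rfl⟩ : ∃ n, D = n + 1 := ⟨D - 1, by omega⟩
  constructor
  have h : ((n + 1 : ℕ) : ℝ) - 1 = n := by push_cast; ring
  rw [uniformSphere, h, Measure.smul_apply, Measure.restrict_apply_univ, smul_eq_mul]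
  exact ENNReal.inv_mul_cancel (hausdorffMeasure_sphere_pos n).ne'
    (hausdorffMeasure_sphere_lt_top n).ne

theorem uniformSphere_sphere_compl (D : ℕ) : uniformSphere D (sphere 0 1)ᶜ = 0 := by
  rw [uniformSphere, Measure.smul_apply, Measure.restrict_apply isClosed_sphere.measurableSet.compl]
  simp

theorem measurePreserving_uniformSphere (D : ℕ)
    (T : EuclideanSpace ℝ (Fin D) ≃ₗᵢ[ℝ] EuclideanSpace ℝ (Fin D)) :
    MeasurePreserving T (uniformSphere D) (uniformSphere D) := by
  have h := (T.toIsometryEquiv.measurePreserving_hausdorffMeasure ((D : ℝ) - 1)).restrict_preimage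
    (isClosed_sphere (x := (0 : EuclideanSpace ℝ (Fin D))) (ε := 1)).measurableSet
  have hS : T.toIsometryEquiv ⁻¹' sphere 0 1 = sphere 0 1 := by
    ext x
    simp
  rw [hS] at h
  exact h.smul_measure _

end HausdorffSphere

section BallDivergence

variable {E : Type*} [NormedAddCommGroup E] [InnerProductSpace ℝ E]

theorem hasLineDerivAt_norm {u : E} (hu : u ≠ 0) (v : E) :
    HasLineDerivAt ℝ (fun x : E ↦ ‖x‖) ⟪‖u‖⁻¹ • u, v⟫ u v := by
  have h0 : ‖u + (0 : ℝ) • v‖ ^ 2 ≠ 0 := by simpa using hu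
  have h1 : HasDerivAt (fun t : ℝ ↦ u + t • v) v 0 := by
    simpa using ((hasDerivAt_id (0 : ℝ)).smul_const v).const_add u
  have h2 := h1.norm_sq.sqrt h0
  simp only [Real.sqrt_sq (norm_nonneg _), zero_smul, add_zero] at h2
  rw [HasLineDerivAt]
  have : ⟪‖u‖⁻¹ • u, v⟫ = 2 * ⟪u, v⟫ / (2 * ‖u‖) := by
    have : ‖u‖ ≠ 0 := norm_ne_zero_iff.2 hu
    rw [real_inner_smul_left]
    field_simp
  rwa [this]

theorem lipschitzWith_max_sub_norm {E : Type*} [SeminormedAddCommGroup E] (R : ℝ) :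
    LipschitzWith 1 fun u : E ↦ max (R - ‖u‖) 0 := by
  refine LipschitzWith.max_const ?_ 0
  refine LipschitzWith.of_dist_le_mul fun x y ↦ ?_
  rw [NNReal.coe_one, one_mul, Real.dist_eq, sub_sub_sub_cancel_left, dist_comm, dist_eq_norm]
  exact abs_norm_sub_norm_le y x

theorem lineDeriv_max_sub_norm {R : ℝ} {u : E} (hu : u ≠ 0) (huR : ‖u‖ ≠ R) (v : E) :
    lineDeriv ℝ (fun u : E ↦ max (R - ‖u‖) 0) u (-v) =
      (closedBall (0 : E) R).indicator (fun u ↦ ⟪‖u‖⁻¹ • u, v⟫) u := by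
  rcases lt_or_gt_of_ne huR with h | h
  · rw [indicator_of_mem (mem_closedBall_zero_iff.2 h.le)]
    have h1 : HasLineDerivAt ℝ (fun x : E ↦ R - ‖x‖) ⟪‖u‖⁻¹ • u, v⟫ u (-v) := by
      have := (hasLineDerivAt_norm hu (-v)).const_sub R
      rwa [inner_neg_right, neg_neg] at this
    refine (h1.congr_of_eventuallyEq ?_).lineDeriv
    filter_upwards [(isOpen_lt continuous_norm continuous_const).mem_nhds h] with x hx
    exact max_eq_left (sub_nonneg.2 (le_of_lt hx))
  · rw [indicator_of_notMem (by simpa using h)]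
    have h1 : HasLineDerivAt ℝ (fun _ : E ↦ (0 : ℝ)) 0 u (-v) := by
      simpa [HasLineDerivAt] using hasDerivAt_const (0 : ℝ) (0 : ℝ)
    refine (h1.congr_of_eventuallyEq ?_).lineDeriv
    filter_upwards [(isOpen_lt continuous_const continuous_norm).mem_nhds h] with x hx
    exact max_eq_right (sub_nonpos.2 (le_of_lt hx))

variable [FiniteDimensional ℝ E]

theorem hasCompactSupport_max_sub_norm (R : ℝ) :
    HasCompactSupport fun u : E ↦ max (R - ‖u‖) 0 := by
  refine HasCompactSupport.intro (isCompact_closedBall (0 : E) R) fun x hx ↦ ?_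
  rw [mem_closedBall_zero_iff, not_le] at hx
  exact max_eq_right (sub_nonpos.2 hx.le)

variable [MeasurableSpace E] [BorelSpace E]

theorem integrableOn_mul_inner_normalize {f : E → ℝ} (hf : Continuous f) (v : E) (R : ℝ) :
    IntegrableOn (fun u ↦ f u * ⟪‖u‖⁻¹ • u, v⟫) (closedBall 0 R) := by
  refine (hf.continuousOn.integrableOn_compact (isCompact_closedBall 0 R)).mul_bdd
    (c := ‖v‖) (by fun_prop) (ae_of_all _ fun u ↦ ?_)
  refine (norm_inner_le_norm _ _).trans (mul_le_of_le_one_left (norm_nonneg v) ?_)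
  rw [norm_smul, norm_inv, norm_norm]
  exact inv_mul_le_one

theorem integral_lineDeriv_mul_max_sub_norm [Nontrivial E] {C : ℝ≥0} {f : E → ℝ}
    (hf : LipschitzWith C f) (v : E) (R : ℝ) :
    ∫ u, lineDeriv ℝ f u v * max (R - ‖u‖) 0 =
      ∫ u in closedBall 0 R, f u * ⟪‖u‖⁻¹ • u, v⟫ := by
  rw [hf.integral_lineDeriv_mul_eq (lipschitzWith_max_sub_norm R)
    (hasCompactSupport_max_sub_norm R), ← integral_indicator isClosed_closedBall.measurableSet]
  have h1 : ∀ᵐ u : E, u ∉ sphere (0 : E) R := measure_eq_zero_iff_ae_notMem.1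
    (Measure.addHaar_sphere volume 0 R)
  have h2 : ∀ᵐ u : E, u ≠ 0 := measure_eq_zero_iff_ae_notMem.1 (measure_singleton (0 : E))
  refine integral_congr_ae ?_
  filter_upwards [h1, h2] with u hu hu0
  rw [lineDeriv_max_sub_norm hu0 (by simpa using hu)]
  by_cases h : u ∈ closedBall (0 : E) R <;> simp [h, mul_comm]

theorem volume_real_annulus {r : ℝ} (hr : 0 ≤ r) (hr1 : r ≤ 1) :
    volume.real (closedBall (0 : E) 1 \ closedBall 0 r) =
      (∑ i ∈ Finset.range (Module.finrank ℝ E), r ^ i) * (1 - r) *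
        volume.real (closedBall (0 : E) 1) := by
  rw [measureReal_sdiff (closedBall_subset_closedBall hr1) isClosed_closedBall.measurableSet
    measure_closedBall_lt_top.ne, Measure.addHaar_real_closedBall' volume _ hr, geom_sum_mul_neg]
  ring

theorem setIntegral_annulus_normalize {σ : Measure E} [IsProbabilityMeasure σ]
    (hσ : ∀ T : E ≃ₗᵢ[ℝ] E, MeasurePreserving T σ σ) (hσS : σ (sphere 0 1)ᶜ = 0)
    {r : ℝ} (hr : 0 ≤ r) {f : E → ℝ} (hf : Continuous f) :
    ∫ u in closedBall 0 1 \ closedBall 0 r, f (‖u‖⁻¹ • u) =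
      volume.real (closedBall (0 : E) 1 \ closedBall 0 r) * ∫ e, f e ∂σ := by
  set A := closedBall (0 : E) 1 \ closedBall 0 r with hA
  have hAm : MeasurableSet A :=
    isClosed_closedBall.measurableSet.diff isClosed_closedBall.measurableSet
  have : IsFiniteMeasure (volume.restrict A) := isFiniteMeasure_restrict.2
    ((measure_mono sdiff_subset).trans_lt measure_closedBall_lt_top).ne
  have hN : Measurable fun u : E ↦ ‖u‖⁻¹ • u := by fun_prop
  have hinv : ∀ T : E ≃ₗᵢ[ℝ] E, MeasurePreserving T
      ((volume.restrict A).map fun u ↦ ‖u‖⁻¹ • u) ((volume.restrict A).map fun u ↦ ‖u‖⁻¹ • u) := by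
    intro T
    have hT := T.measurePreserving.restrict_preimage hAm
    have hTA : T ⁻¹' A = A := by
      ext u
      simp [hA]
    rw [hTA] at hT
    refine ⟨T.continuous.measurable, ?_⟩
    have hcomp : (T ∘ fun u : E ↦ ‖u‖⁻¹ • u) = (fun u : E ↦ ‖u‖⁻¹ • u) ∘ T := by
      ext u
      simp
    rw [Measure.map_map T.continuous.measurable hN, hcomp,
      ← Measure.map_map hN T.continuous.measurable, hT.map_eq]
  have hS : (volume.restrict A).map (fun u ↦ ‖u‖⁻¹ • u) (sphere 0 1)ᶜ = 0 := by
    rw [Measure.map_apply hN isClosed_sphere.measurableSet.compl,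
      Measure.restrict_apply (hN isClosed_sphere.measurableSet.compl)]
    convert measure_empty (μ := volume)
    ext u
    simp only [hA, mem_inter_iff, mem_preimage, mem_compl_iff, mem_sphere_zero_iff_norm,
      mem_sdiff, mem_closedBall_zero_iff, mem_empty_iff_false, iff_false, not_and, not_le,
      norm_smul, norm_inv, norm_norm]
    intro h h1
    by_contra! h2
    exact h (inv_mul_cancel₀ (hr.trans_lt h2).ne')
  rw [← integral_map (φ := fun u : E ↦ ‖u‖⁻¹ • u) hN.aemeasurable
    hf.measurable.aestronglyMeasurable,
    integral_eq_mul_integral_of_measurePreserving hσ hinv hσS hS hf, measureReal_def,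
    Measure.map_apply hN MeasurableSet.univ, preimage_univ, Measure.restrict_apply_univ,
    measureReal_def]

/-- The divergence theorem on the unit ball, for Lipschitz functions. -/
theorem setIntegral_lineDeriv_closedBall [Nontrivial E] {σ : Measure E} [IsProbabilityMeasure σ]
    (hσ : ∀ T : E ≃ₗᵢ[ℝ] E, MeasurePreserving T σ σ) (hσS : σ (sphere 0 1)ᶜ = 0)
    {C : ℝ≥0} {f : E → ℝ} (hf : LipschitzWith C f) (v : E) :
    ∫ u in closedBall 0 1, lineDeriv ℝ f u v =
      Module.finrank ℝ E * volume.real (closedBall (0 : E) 1) * ∫ e, f e * ⟪e, v⟫ ∂σ := by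
  set ω := volume.real (closedBall (0 : E) 1)
  set J := ∫ u in closedBall 0 1, lineDeriv ℝ f u v
  set I := ∫ e, f e * ⟪e, v⟫ ∂σ
  let S : ℝ → ℝ := fun r ↦ ∑ i ∈ Finset.range (Module.finrank ℝ E), r ^ i
  have hbound : ∀ r ∈ Ioo (0 : ℝ) 1,
      |J - S r * ω * I| ≤ 2 * (C * ‖v‖) * (S r * (1 - r) * ω) := by
    intro r ⟨hr0, hr1⟩
    have hr : 0 < 1 - r := sub_pos.2 hr1
    set A := closedBall (0 : E) 1 \ closedBall 0 r with hA
    have hAm : MeasurableSet A :=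
      isClosed_closedBall.measurableSet.diff isClosed_closedBall.measurableSet
    have hAfin : volume A < ⊤ := (measure_mono sdiff_subset).trans_lt measure_closedBall_lt_top
    have hvol : volume.real A = S r * (1 - r) * ω := volume_real_annulus hr0.le hr1.le
    have hlin : LocallyIntegrable (fun u ↦ lineDeriv ℝ f u v) volume :=
      hf.locallyIntegrable_lineDeriv v
    have hlinB : IntegrableOn (fun u ↦ lineDeriv ℝ f u v) (closedBall 0 1) :=
      hlin.integrableOn_isCompact (isCompact_closedBall 0 1)
    have hψ : ∀ R : ℝ, Integrable fun u : E ↦ lineDeriv ℝ f u v * max (R - ‖u‖) 0 := fun R ↦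
      hlin.integrable_smul_right_of_hasCompactSupport (lipschitzWith_max_sub_norm R).continuous
        (hasCompactSupport_max_sub_norm R)
    have hdiff : Integrable fun u : E ↦
        lineDeriv ℝ f u v * max (1 - ‖u‖) 0 - lineDeriv ℝ f u v * max (r - ‖u‖) 0 :=
      (hψ 1).sub (hψ r)
    have hparts : ∫ u in A, f u * ⟪‖u‖⁻¹ • u, v⟫ =
        ∫ u, (lineDeriv ℝ f u v * max (1 - ‖u‖) 0 - lineDeriv ℝ f u v * max (r - ‖u‖) 0) := by
      rw [integral_sub (hψ 1) (hψ r), integral_lineDeriv_mul_max_sub_norm hf,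
        integral_lineDeriv_mul_max_sub_norm hf,
        setIntegral_sdiff isClosed_closedBall.measurableSet
          (integrableOn_mul_inner_normalize hf.continuous v 1)
          (closedBall_subset_closedBall hr1.le)]
    have hcut : |(∫ u in A, f u * ⟪‖u‖⁻¹ • u, v⟫) - (1 - r) * J| ≤
        (1 - r) * (C * ‖v‖) * volume.real A := by
      have hJ : (1 - r) * J = ∫ u, (closedBall (0 : E) 1).indicator
          (fun u ↦ (1 - r) * lineDeriv ℝ f u v) u := by
        rw [integral_indicator isClosed_closedBall.measurableSet, integral_const_mul]
      rw [hparts, hJ, ← integral_sub hdiff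
        (IntegrableOn.integrable_indicator (hlinB.const_mul (1 - r))
          isClosed_closedBall.measurableSet),
        mul_comm _ (volume.real A), ← smul_eq_mul (volume.real A), ← setIntegral_const,
        ← integral_indicator hAm, ← Real.norm_eq_abs]
      refine norm_integral_le_of_norm_le
        (IntegrableOn.integrable_indicator (integrableOn_const hAfin.ne) hAm) (ae_of_all _ fun u ↦ ?_)
      have hld : ‖lineDeriv ℝ f u v‖ ≤ C * ‖v‖ := norm_lineDeriv_le_of_lipschitz ℝ hf
      by_cases h1 : ‖u‖ ≤ 1
      · rw [indicator_of_mem (mem_closedBall_zero_iff.2 h1), max_eq_left (sub_nonneg.2 h1)]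
        by_cases h2 : ‖u‖ ≤ r
        · rw [indicator_of_notMem (by simp [hA, h2]), max_eq_left (sub_nonneg.2 h2)]
          rw [norm_le_zero_iff]
          ring
        · rw [indicator_of_mem (by simpa [hA, h1] using h2),
            max_eq_right (sub_nonpos.2 (le_of_not_ge h2)), mul_zero, sub_zero,
            mul_comm _ (1 - ‖u‖), ← sub_mul, norm_mul]
          refine mul_le_mul ?_ hld (norm_nonneg _) hr.le
          rw [Real.norm_eq_abs, abs_le]
          constructor <;> linarith [norm_nonneg u]
      · have h1' := not_le.1 h1
        rw [indicator_of_notMem (by simpa using h1'), indicator_of_notMem (by simp [hA, h1']),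
          max_eq_right (sub_nonpos.2 h1'.le), max_eq_right (sub_nonpos.2 (hr1.trans h1').le)]
        simp
    have hcont : Continuous fun e : E ↦ f e * ⟪e, v⟫ := by
      have := hf.continuous
      fun_prop
    have hnorm : |(∫ u in A, f u * ⟪‖u‖⁻¹ • u, v⟫) - volume.real A * I| ≤
        (1 - r) * (C * ‖v‖) * volume.real A := by
      have hNle : ∀ u ∈ A, ‖‖u‖⁻¹ • u‖ = 1 := by
        intro u hu
        have hu : ‖u‖ ≤ 1 ∧ r < ‖u‖ := by simpa [hA] using hu
        rw [norm_smul, norm_inv, norm_norm, inv_mul_cancel₀ (hr0.trans hu.2).ne']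
      have hint2 : IntegrableOn (fun u ↦ f (‖u‖⁻¹ • u) * ⟪‖u‖⁻¹ • u, v⟫) A := by
        obtain ⟨K, hK⟩ := (isCompact_sphere (0 : E) 1).exists_bound_of_continuousOn
          hcont.continuousOn
        refine Measure.integrableOn_of_bounded (M := K) hAfin.ne
          (hcont.measurable.comp
            (by fun_prop : Measurable fun u : E ↦ ‖u‖⁻¹ • u)).aestronglyMeasurable
          ((ae_restrict_iff' hAm).2 (ae_of_all _ fun u hu ↦ ?_))
        exact hK (‖u‖⁻¹ • u) (mem_sphere_zero_iff_norm.2 (hNle u hu))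
      rw [← setIntegral_annulus_normalize hσ hσS hr0.le hcont, ← integral_sub
        ((integrableOn_mul_inner_normalize hf.continuous v 1).mono_set sdiff_subset) hint2,
        ← Real.norm_eq_abs]
      refine norm_setIntegral_le_of_norm_le_const hAfin fun u hu ↦ ?_
      have hN := hNle u hu
      have hu : ‖u‖ ≤ 1 ∧ r < ‖u‖ := by simpa [hA] using hu
      rw [← sub_mul, norm_mul]
      have hdist : ‖u - ‖u‖⁻¹ • u‖ ≤ 1 - r := by
        have hu0 : ‖u‖ ≠ 0 := (hr0.trans hu.2).ne'
        have : u - ‖u‖⁻¹ • u = (‖u‖ - 1) • (‖u‖⁻¹ • u) := by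
          rw [sub_smul, smul_smul, mul_inv_cancel₀ hu0, one_smul, one_smul]
        rw [this, norm_smul, hN, mul_one, Real.norm_eq_abs, abs_le]
        constructor <;> linarith
      have hinner : ‖⟪‖u‖⁻¹ • u, v⟫‖ ≤ ‖v‖ := by
        simpa [hN] using norm_inner_le_norm (𝕜 := ℝ) (‖u‖⁻¹ • u) v
      calc ‖f u - f (‖u‖⁻¹ • u)‖ * ‖⟪‖u‖⁻¹ • u, v⟫‖
          ≤ (C * (1 - r)) * ‖v‖ := by
            refine mul_le_mul ((hf.norm_sub_le _ _).trans ?_) hinner (norm_nonneg _) (by positivity)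
            exact mul_le_mul_of_nonneg_left hdist C.2
        _ = (1 - r) * (C * ‖v‖) := by ring
    rw [hvol] at hcut hnorm
    refine le_of_mul_le_mul_left ?_ hr
    calc (1 - r) * |J - S r * ω * I|
        = |(1 - r) * J - S r * (1 - r) * ω * I| := by
          rw [← abs_of_pos hr, ← abs_mul, abs_of_pos hr]
          ring_nf
      _ ≤ _ := by
          rw [abs_le] at hcut hnorm ⊢
          constructor <;> linarith [hcut.1, hcut.2, hnorm.1, hnorm.2]
  have hS1 : S 1 = Module.finrank ℝ E := by simp [S]
  have hlim : |J - S 1 * ω * I| ≤ 2 * (C * ‖v‖) * (S 1 * (1 - 1) * ω) := by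
    have hcl : (1 : ℝ) ∈ closure (Ioo (0 : ℝ) 1) := by
      rw [closure_Ioo zero_ne_one]
      simp
    exact le_on_closure hbound (by fun_prop) (by fun_prop) hcl
  rw [sub_self, mul_zero, zero_mul, mul_zero, hS1] at hlim
  exact eq_of_abs_sub_nonpos hlim

end BallDivergence

section UniformBall

variable {D : ℕ}

instance isProbabilityMeasure_uniformBall : IsProbabilityMeasure (uniformBall D) := by
  constructor
  rw [uniformBall, Measure.smul_apply, Measure.restrict_apply_univ, smul_eq_mul]
  exact ENNReal.inv_mul_cancel (measure_closedBall_pos _ _ one_pos).ne'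
    measure_closedBall_lt_top.ne

theorem uniformBall_absolutelyContinuous : uniformBall D ≪ volume :=
  Measure.smul_absolutelyContinuous.trans Measure.restrict_le_self.absolutelyContinuous

theorem integral_uniformBall (f : EuclideanSpace ℝ (Fin D) → ℝ) :
    ∫ u, f u ∂uniformBall D =
      (volume.real (closedBall (0 : EuclideanSpace ℝ (Fin D)) 1))⁻¹ *
        ∫ u in closedBall 0 1, f u := by
  rw [uniformBall, integral_smul_measure, ENNReal.toReal_inv, smul_eq_mul, measureReal_def]

theorem integrable_uniformBall {f : EuclideanSpace ℝ (Fin D) → ℝ} (hf : Continuous f) :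
    Integrable f (uniformBall D) :=
  Integrable.smul_measure (hf.continuousOn.integrableOn_compact (isCompact_closedBall 0 1))
    (ENNReal.inv_ne_top.2 (measure_closedBall_pos _ _ one_pos).ne')

variable {F : EuclideanSpace ℝ (Fin D) → ℝ} {C : ℝ≥0}

theorem lipschitzWith_smoothed (hF : LipschitzWith C F) (γ : ℝ) :
    LipschitzWith C (smoothed D F γ) := by
  have hint : ∀ x, Integrable (fun u ↦ F (x + γ • u)) (uniformBall D) := fun x ↦
    integrable_uniformBall (hF.continuous.comp (by fun_prop))
  refine LipschitzWith.of_dist_le_mul fun x y ↦ ?_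
  rw [dist_eq_norm, smoothed, smoothed, ← integral_sub (hint x) (hint y)]
  refine (norm_integral_le_of_norm_le_const (C := C * dist x y) (ae_of_all _ fun u ↦ ?_)).trans ?_
  · rw [← dist_eq_norm]
    simpa using hF.dist_le_mul (x + γ • u) (y + γ • u)
  · simp

theorem hasDerivAt_integral_uniformBall {f : EuclideanSpace ℝ (Fin D) → ℝ}
    (hf : LipschitzWith C f) (v : EuclideanSpace ℝ (Fin D)) :
    HasDerivAt (fun t : ℝ ↦ ∫ u, f (u + t • v) ∂uniformBall D)
      (∫ u, lineDeriv ℝ f u v ∂uniformBall D) 0 := by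
  have hcont : ∀ t : ℝ, Continuous fun u ↦ f (u + t • v) := fun t ↦
    hf.continuous.comp (by fun_prop)
  refine (hasDerivAt_integral_of_dominated_loc_of_lip (F := fun (t : ℝ) u ↦ f (u + t • v))
    (bound := fun _ ↦ (C * ‖v‖₊ : ℝ≥0)) Filter.univ_mem
    (.of_forall fun t ↦ (hcont t).measurable.aestronglyMeasurable)
    (integrable_uniformBall (hcont 0)) (aestronglyMeasurable_lineDeriv hf.continuous _)
    (ae_of_all _ fun u ↦ LipschitzWith.lipschitzOnWith ?_) (integrable_const _) ?_).2
  · refine LipschitzWith.of_dist_le_mul fun s t ↦ ?_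
    refine (hf.dist_le_mul _ _).trans_eq ?_
    rw [dist_add_left, dist_eq_norm, ← sub_smul, norm_smul, ← dist_eq_norm]
    simp
    ring
  · filter_upwards [uniformBall_absolutelyContinuous.ae_le (hf.ae_lineDifferentiableAt v)]
      with u hu
    exact hu.hasLineDerivAt

theorem hasGradientAt_smoothed (hD : 0 < D) {γ : ℝ} (hγ : 0 < γ) (hF : LipschitzWith C F)
    (x : EuclideanSpace ℝ (Fin D)) :
    HasGradientAt (smoothed D F γ)
      (((D : ℝ) / γ) • ∫ e, F (x + γ • e) • e ∂(uniformSphere D)) x := by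
  have : Nonempty (Fin D) := ⟨⟨0, hD⟩⟩
  have := isProbabilityMeasure_uniformSphere hD
  have hf : LipschitzWith (C * ‖γ‖₊) fun u ↦ F (x + γ • u) := by
    refine LipschitzWith.of_dist_le_mul fun u w ↦ (hF.dist_le_mul _ _).trans_eq ?_
    rw [dist_add_left, dist_smul₀]
    simp [mul_assoc]
  have hint : Integrable (fun e ↦ F (x + γ • e) • e) (uniformSphere D) :=
    integrable_of_continuous_of_sphere_compl_null (uniformSphere_sphere_compl D)
      (hf.continuous.smul continuous_id)
  refine (lipschitzWith_smoothed hF γ).hasFDerivAt_of_hasLineDerivAt_of_closure (s := univ)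
    (by simp) fun v _ ↦ ?_
  have hB : volume.real (closedBall (0 : EuclideanSpace ℝ (Fin D)) 1) ≠ 0 :=
    (ENNReal.toReal_pos (measure_closedBall_pos _ _ one_pos).ne'
      measure_closedBall_lt_top.ne).ne'
  have h := hasDerivAt_integral_uniformBall hf (γ⁻¹ • v)
  rw [integral_uniformBall, setIntegral_lineDeriv_closedBall
    (measurePreserving_uniformSphere D) (uniformSphere_sphere_compl D) hf] at h
  have hfun : (fun t : ℝ ↦ smoothed D F γ (x + t • v)) =
      fun t ↦ ∫ u, F (x + γ • (u + t • γ⁻¹ • v)) ∂uniformBall D := by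
    ext t
    refine integral_congr_ae (ae_of_all _ fun u ↦ ?_)
    simp only [smul_add, smul_smul, mul_left_comm γ t, mul_inv_cancel₀ hγ.ne', mul_one]
    rw [add_assoc, add_comm (t • v)]
  have hI : ⟪(((D : ℝ) / γ) • ∫ e, F (x + γ • e) • e ∂(uniformSphere D)), v⟫ =
      D / γ * ∫ e, F (x + γ • e) * ⟪e, v⟫ ∂(uniformSphere D) := by
    rw [real_inner_smul_left, real_inner_comm, ← integral_inner hint]
    simp only [real_inner_smul_right, real_inner_comm]
  rw [HasLineDerivAt, InnerProductSpace.toDual_apply_apply, hfun, hI]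
  refine h.congr_deriv ?_
  simp only [real_inner_smul_right, mul_left_comm _ γ⁻¹, integral_const_mul,
    finrank_euclideanSpace_fin]
  field_simp

end UniformBall

theorem integral_sub_smul_uniformSphere {D : ℕ} (hD : 0 < D)
    {f : EuclideanSpace ℝ (Fin D) → ℝ} (hf : Continuous f) :
    ∫ e, (f e - f (-e)) • e ∂(uniformSphere D) = (2 : ℝ) • ∫ e, f e • e ∂(uniformSphere D) := by
  have := isProbabilityMeasure_uniformSphere hD
  have hint : ∀ {g : EuclideanSpace ℝ (Fin D) → ℝ}, Continuous g →
      Integrable (fun e ↦ g e • e) (uniformSphere D) := fun hg ↦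
    integrable_of_continuous_of_sphere_compl_null (uniformSphere_sphere_compl D)
      (hg.smul continuous_id)
  have hneg : ∫ e, f (-e) • e ∂(uniformSphere D) = -∫ e, f e • e ∂(uniformSphere D) := by
    rw [← integral_neg, ← (measurePreserving_uniformSphere D (.neg ℝ)).integral_comp
      (LinearIsometryEquiv.neg ℝ).toHomeomorph.measurableEmbedding]
    simp
  simp only [sub_smul]
  rw [integral_sub (hint hf) (hint (g := fun e ↦ f (-e)) (by fun_prop)), hneg, sub_neg_eq_add, two_smul]

/-- Sphere-smoothing gradient identity: if `F : ℝ^D → ℝ` is `M₂`-Lipschitz in the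
Euclidean norm, then `F_γ` is differentiable and for every `x`:
`∇F_γ(x) = (D/γ)·E[F(x + γe)·e] = (D/(2γ))·E[(F(x + γe) − F(x − γe))·e]`,
with `e` uniform on the Euclidean unit sphere. -/
theorem sphere_smoothing_gradient_identity
    (D : ℕ) (hD : 0 < D) (γ : ℝ) (hγ : 0 < γ)
    (F : EuclideanSpace ℝ (Fin D) → ℝ) (M₂ : ℝ)
    (hlip : ∀ x y : EuclideanSpace ℝ (Fin D), |F y - F x| ≤ M₂ * ‖y - x‖) :
    Differentiable ℝ (smoothed D F γ) ∧
      ∀ x : EuclideanSpace ℝ (Fin D),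
        gradient (smoothed D F γ) x =
            ((D : ℝ) / γ) • ∫ e, F (x + γ • e) • e ∂(uniformSphere D) ∧
          gradient (smoothed D F γ) x =
            ((D : ℝ) / (2 * γ)) • ∫ e, (F (x + γ • e) - F (x - γ • e)) • e
              ∂(uniformSphere D) := by
  have hF : LipschitzWith M₂.toNNReal F := by
    refine LipschitzWith.of_dist_le_mul fun x y ↦ ?_
    rw [Real.dist_eq, dist_eq_norm]
    exact (hlip y x).trans (mul_le_mul_of_nonneg_right (Real.le_coe_toNNReal M₂) (norm_nonneg _))
  have hgrad := hasGradientAt_smoothed hD hγ hF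
  refine ⟨fun x ↦ (hgrad x).differentiableAt, fun x ↦ ⟨(hgrad x).gradient, ?_⟩⟩
  have hcont : Continuous fun e ↦ F (x + γ • e) := hF.continuous.comp (by fun_prop)
  have h := integral_sub_smul_uniformSphere hD hcont
  simp only [smul_neg, ← sub_eq_add_neg] at h
  rw [(hgrad x).gradient, h, smul_smul]
  congr 1
  field_simp
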